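/- Let n ≥ 1 be a natural number and let α, β be integers with Ψ(α, β, 2n) ≠ 0. Then Ω_0(n | α, β | 2n) = Ψ(α, β, 2n) · ∏_{j=n}^{2n-1} j; that is, the ratio Ω_0(n | α, β | 2n) / Ψ(α, β, 2n) equals the product n·(n+1)⋯(2n-1). -/

import Mathlib

/-- The `Ψ` sequence: `Ψ a b 0 = 2`, `Ψ a b 1 = 1`, and
`Ψ a b (m+2) = (2a-b)^(δ(m+1)) * Ψ a b (m+1) - a * Ψ a b m`. -/
def psiZ (a b : ℤ) : ℕ → ℤ
  | 0 => 2
  | 1 => 1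
  | m + 2 => (2 * a - b) ^ ((m + 1) % 2) * psiZ a b (m + 1) - a * psiZ a b m

/-- The Omega sequence `Ω_r(k | ζ, ξ | n)`: `Ω_r(0) = 1` and
`Ω_r(k+1) = (2ζ-ξ)(n-r-(k+1))·Ω_r(k) - 2ζ(n-2r-δ(n-1))·Ω_{r+1}(k)`. -/
def omegaZ (ζ ξ : ℤ) (n : ℕ) : ℕ → ℕ → ℤ
  | _, 0 => 1
  | r, k + 1 =>
    (2 * ζ - ξ) * ((n : ℤ) - r - (k + 1)) * omegaZ ζ ξ n r k
      - 2 * ζ * ((n : ℤ) - 2 * r - ((n - 1) % 2 : ℕ)) * omegaZ ζ ξ n (r + 1) k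

open Finset

/-- The homogeneous form `∑ i ≤ k, f i * x ^ i * c ^ (k - i)` of degree `k`. -/
def homogSum (c x : ℤ) (f : ℕ → ℤ) (k : ℕ) : ℤ :=
  ∑ i ∈ range (k + 1), f i * x ^ i * c ^ (k - i)

lemma homogSum_succ_of_pascal (c x : ℤ) {f g h : ℕ → ℤ} (k : ℕ) (h_zero : h 0 = f 0)
    (h_succ : ∀ i, h (i + 1) = f (i + 1) + g i) :
    homogSum c x h (k + 1) = homogSum c x f (k + 1) + x * homogSum c x g k := by
  unfold homogSum
  rw [sum_range_succ', sum_range_succ' _ (k + 1), mul_sum, h_zero, add_right_comm,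
    ← sum_add_distrib]
  congr 1
  refine sum_congr rfl fun i _ => ?_
  rw [h_succ, Nat.add_sub_add_right]
  ring

lemma homogSum_succ_of_top_eq_zero (c x : ℤ) {f : ℕ → ℤ} {k : ℕ} (hf : f (k + 1) = 0) :
    homogSum c x f (k + 1) = c * homogSum c x f k := by
  unfold homogSum
  rw [sum_range_succ, hf, mul_sum, zero_mul, zero_mul, add_zero]
  refine sum_congr rfl fun i hi => ?_
  rw [Nat.succ_sub (Nat.lt_succ_iff.mp (mem_range.mp hi)), pow_succ]
  ring

lemma homogSum_const_mul (c x d : ℤ) (f : ℕ → ℤ) (k : ℕ) :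
    homogSum c x (fun i => d * f i) k = d * homogSum c x f k := by
  simp only [homogSum, mul_sum, mul_assoc]

/-- The coefficients of the Lucas polynomials. -/
def lucasCoeff : ℕ → ℕ → ℤ
  | 0, 0 => 2
  | 0, _ + 1 => 0
  | _ + 1, 0 => 1
  | 1, _ + 1 => 0
  | m + 2, i + 1 => lucasCoeff (m + 1) (i + 1) + lucasCoeff m i

lemma lucasCoeff_eq_zero_of_lt (m i : ℕ) (h : m < 2 * i) : lucasCoeff m i = 0 := by
  induction m using Nat.twoStepInduction generalizing i with
  | zero => obtain _ | i := i <;> simp_all [lucasCoeff]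
  | one => obtain _ | i := i <;> simp_all [lucasCoeff]
  | more m ih₀ ih₁ =>
    obtain _ | i := i
    · omega
    · rw [lucasCoeff, ih₁ _ (by omega), ih₀ _ (by omega), add_zero]

lemma mul_lucasCoeff_add (s i : ℕ) :
    (s : ℤ) * lucasCoeff (s + i) i = (s + i) * (s.choose i : ℤ) := by
  induction s generalizing i with
  | zero => obtain _ | i := i <;> simp
  | succ s ih =>
    obtain _ | i := i
    · simp [lucasCoeff]
    · rw [show s + 1 + (i + 1) = s + i + 2 by ring, lucasCoeff]
      obtain rfl | hs := Nat.eq_zero_or_pos s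
      · obtain _ | i := i
        · simp [lucasCoeff]
        · simp [lucasCoeff_eq_zero_of_lt (i + 1 + 1) (i + 1 + 1) (by omega),
            lucasCoeff_eq_zero_of_lt (i + 1) (i + 1) (by omega), Nat.choose_eq_zero_of_lt]
      · have h₁ := ih (i + 1)
        have h₀ := ih i
        have h_choose : ((s : ℤ) - i) * s.choose i = s.choose (i + 1) * (i + 1) := by
          obtain h | h := le_or_gt i s
          · have := Nat.choose_succ_right_eq s i
            zify [h] at this
            linarith
          · simp [Nat.choose_eq_zero_of_lt h, Nat.choose_eq_zero_of_lt (Nat.lt_succ_of_lt h)]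
        rw [← add_assoc] at h₁
        have hs' : (s : ℤ) ≠ 0 := by positivity
        apply mul_left_cancel₀ hs'
        rw [Nat.choose_succ_succ]
        push_cast at h₁ ⊢
        linear_combination ((s : ℤ) + 1) * (h₁ + h₀) - h_choose

lemma psiZ_eq_homogSum (a b : ℤ) (n : ℕ) :
    psiZ a b (2 * n) = homogSum (2 * a - b) (-a) (lucasCoeff (2 * n)) n ∧
      psiZ a b (2 * n + 1) = homogSum (2 * a - b) (-a) (lucasCoeff (2 * n + 1)) n := by
  induction n with
  | zero => simp [psiZ, homogSum, lucasCoeff]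
  | succ n ih =>
    have h_even : psiZ a b (2 * (n + 1)) =
        homogSum (2 * a - b) (-a) (lucasCoeff (2 * (n + 1))) (n + 1) := by
      rw [show 2 * (n + 1) = 2 * n + 2 by ring, psiZ, ih.1, ih.2,
        homogSum_succ_of_pascal (f := lucasCoeff (2 * n + 1)) (g := lucasCoeff (2 * n)) _ _ _
          (by simp [lucasCoeff]) (fun i => by rw [lucasCoeff]),
        homogSum_succ_of_top_eq_zero _ _ (lucasCoeff_eq_zero_of_lt _ _ (by omega)),
        show (2 * n + 1) % 2 = 1 by omega]
      ring
    refine ⟨h_even, ?_⟩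
    rw [show 2 * (n + 1) + 1 = (2 * n + 1) + 2 by ring, psiZ, ih.2,
      show 2 * n + 1 + 1 = 2 * (n + 1) by ring, h_even,
      homogSum_succ_of_pascal (h := lucasCoeff (2 * n + 1 + 2)) (f := lucasCoeff (2 * (n + 1)))
        (g := lucasCoeff (2 * n + 1)) _ _ _
        (by simp [mul_add, lucasCoeff]) (fun i => by rw [lucasCoeff]; rfl),
      show 2 * (n + 1) % 2 = 0 by omega]
    ring

/-- The coefficients of `Ω_r(k | ζ, ξ | N)`, for even `N`, as a form in `2ζ - ξ` and `-2ζ`. -/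
def omegaCoeff (N : ℤ) (r k i : ℕ) : ℤ :=
  k.choose i * (∏ j ∈ range i, (N - 2 * r - 1 - 2 * j)) * ∏ j ∈ Ico i k, (N - r - 1 - j)

lemma omegaCoeff_succ_zero (N : ℤ) (r k : ℕ) :
    omegaCoeff N r (k + 1) 0 = (N - r - (k + 1)) * omegaCoeff N r k 0 := by
  simp only [omegaCoeff, prod_Ico_succ_top (Nat.zero_le k)]
  simp
  ring

lemma omegaCoeff_succ_succ (N : ℤ) (r k i : ℕ) :
    omegaCoeff N r (k + 1) (i + 1) = (N - r - (k + 1)) * omegaCoeff N r k (i + 1) +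
      (N - 2 * r - 1) * omegaCoeff N (r + 1) k i := by
  have h_shift : ∏ j ∈ Ico i k, (N - (r + 1 : ℕ) - 1 - j) =
      ∏ j ∈ Ico (i + 1) (k + 1), (N - r - 1 - j) := by
    rw [← prod_Ico_add']
    refine prod_congr rfl fun j _ => ?_
    push_cast
    ring
  have h_range : ∏ j ∈ range (i + 1), (N - 2 * r - 1 - 2 * j) =
      (N - 2 * r - 1) * ∏ j ∈ range i, (N - 2 * (r + 1 : ℕ) - 1 - 2 * j) := by
    rw [prod_range_succ', mul_comm]
    congr 1
    · simp
    · refine prod_congr rfl fun j _ => ?_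
      push_cast
      ring
  have h_top : (k.choose (i + 1) : ℤ) * ∏ j ∈ Ico (i + 1) (k + 1), (N - r - 1 - j) =
      k.choose (i + 1) * ((∏ j ∈ Ico (i + 1) k, (N - r - 1 - j)) * (N - r - 1 - k)) := by
    obtain h | h := le_or_gt (i + 1) k
    · rw [prod_Ico_succ_top h]
    · simp [Nat.choose_eq_zero_of_lt h]
  simp only [omegaCoeff]
  rw [h_shift, Nat.choose_succ_succ]
  push_cast at h_range ⊢
  linear_combination (∏ j ∈ range (i + 1), (N - 2 * r - 1 - 2 * (j : ℤ))) * h_top +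
    k.choose i * (∏ j ∈ Ico (i + 1) (k + 1), (N - r - 1 - (j : ℤ))) * h_range

lemma omegaZ_eq_homogSum (ζ ξ : ℤ) {N : ℕ} (hN : (N - 1) % 2 = 1) (r k : ℕ) :
    omegaZ ζ ξ N r k = homogSum (2 * ζ - ξ) (-(2 * ζ)) (omegaCoeff N r k) k := by
  induction k generalizing r with
  | zero => simp [omegaZ, homogSum, omegaCoeff]
  | succ k ih =>
    rw [omegaZ, ih, ih, hN, homogSum_succ_of_pascal
      (f := fun i => ((N : ℤ) - r - (k + 1)) * omegaCoeff N r k i)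
      (g := fun i => ((N : ℤ) - 2 * r - 1) * omegaCoeff N (r + 1) k i) _ _ _
      (omegaCoeff_succ_zero N r k) (omegaCoeff_succ_succ N r k), homogSum_succ_of_top_eq_zero, homogSum_const_mul,
      homogSum_const_mul]
    · push_cast
      ring
    · simp [omegaCoeff]

lemma factorial_mul_choose_eq_prod (n i : ℕ) :
    (i.factorial : ℤ) * n.choose i = ∏ j ∈ range i, ((n : ℤ) - j) := by
  rw [← descPochhammer_eval_eq_prod_range, descPochhammer_eval_eq_descFactorial,
    Nat.descFactorial_eq_factorial_mul_choose]
  push_cast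
  rfl

lemma two_pow_mul_prod_mul_prod (x : ℤ) (i : ℕ) :
    2 ^ i * (∏ j ∈ range i, (x - j)) * ∏ j ∈ range i, (2 * x - 1 - 2 * j) =
      ∏ j ∈ range (i + i), (2 * x - j) := by
  induction i with
  | zero => simp
  | succ i ih =>
    rw [show i + 1 + (i + 1) = i + i + 1 + 1 by ring]
    simp only [prod_range_succ]
    rw [← ih]
    push_cast
    ring

lemma two_pow_mul_choose_mul_prod {n i : ℕ} (hn : 1 ≤ n) (hi : i ≤ n) :
    2 ^ i * (n.choose i : ℤ) * ∏ j ∈ range i, (2 * (n : ℤ) - 1 - 2 * j) =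
      lucasCoeff (2 * n) i * ∏ j ∈ range i, (2 * (n : ℤ) - 1 - j) := by
  have h_lucas := mul_lucasCoeff_add (2 * n - i) i
  have h_choose := factorial_mul_choose_eq_prod (2 * n - i) i
  rw [Nat.sub_add_cancel (by omega)] at h_lucas
  rw [Nat.cast_sub (by omega)] at h_lucas h_choose
  push_cast at h_lucas h_choose
  have h_double := two_pow_mul_prod_mul_prod n i
  rw [← factorial_mul_choose_eq_prod, prod_range_add] at h_double
  have h_shift : 2 * (n : ℤ) * ∏ j ∈ range i, (2 * (n : ℤ) - 1 - j) =
      (∏ j ∈ range i, (2 * (n : ℤ) - j)) * (2 * n - i) := by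
    rw [← prod_range_succ, prod_range_succ', mul_comm]
    congr 1
    refine prod_congr rfl fun j _ => ?_
    push_cast
    ring
  have h_split : ∏ j ∈ range i, (2 * (n : ℤ) - ((i + j : ℕ) : ℤ)) =
      ∏ j ∈ range i, (2 * (n : ℤ) - i - j) := by
    refine prod_congr rfl fun j _ => ?_
    push_cast
    ring
  rw [h_split, ← h_choose] at h_double
  have h_ne : (2 * (n : ℤ) - i) * i.factorial ≠ 0 :=
    mul_ne_zero (by omega) (by positivity)
  apply mul_left_cancel₀ h_ne
  linear_combination (2 * (n : ℤ) - i) * h_double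
    - i.factorial * (2 * n - i).choose i * h_shift
    - i.factorial * (∏ j ∈ range i, (2 * (n : ℤ) - 1 - j)) * h_lucas

lemma prod_Icc_eq_prod_range {n : ℕ} (hn : 1 ≤ n) :
    ∏ j ∈ Icc n (2 * n - 1), (j : ℤ) = ∏ j ∈ range n, (2 * (n : ℤ) - 1 - j) := by
  rw [← prod_range_reflect, show Icc n (2 * n - 1) = Ico n (2 * n) by ext; simp; omega,
    prod_Ico_eq_prod_range, show 2 * n - n = n by omega]
  refine prod_congr rfl fun j hj => ?_
  have := mem_range.mp hj
  omega

lemma omegaZ_eq_psiZ_mul_prod {n : ℕ} (hn : 1 ≤ n) (α β : ℤ) :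
    omegaZ α β (2 * n) 0 n = psiZ α β (2 * n) * ∏ j ∈ Icc n (2 * n - 1), (j : ℤ) := by
  rw [omegaZ_eq_homogSum _ _ (by omega), (psiZ_eq_homogSum α β n).1, prod_Icc_eq_prod_range hn]
  simp only [homogSum, sum_mul]
  refine sum_congr rfl fun i hi => ?_
  have h_le : i ≤ n := Nat.lt_succ_iff.mp (mem_range.mp hi)
  rw [← prod_range_mul_prod_Ico _ h_le, show -(2 * α) = 2 * -α by ring, mul_pow]
  simp only [omegaCoeff]
  push_cast
  simp only [sub_zero]
  linear_combination (-α) ^ i * (2 * α - β) ^ (n - i) *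
    (∏ j ∈ Ico i n, (2 * (n : ℤ) - 1 - j)) * two_pow_mul_choose_mul_prod hn h_le

theorem omega_first_fundamental_v2
    (n : ℕ) (hn : 1 ≤ n) (α β : ℤ) (hpsi : psiZ α β (2 * n) ≠ 0) :
    omegaZ α β (2 * n) 0 n = psiZ α β (2 * n) * ∏ j ∈ Finset.Icc n (2 * n - 1), (j : ℤ) ∧
    omegaZ α β (2 * n) 0 n / psiZ α β (2 * n) = ∏ j ∈ Finset.Icc n (2 * n - 1), (j : ℤ) := by
  have h := omegaZ_eq_psiZ_mul_prod hn α β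
  exact ⟨h, by rw [h, Int.mul_ediv_cancel_left _ hpsi]⟩
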